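/- Let M, K, ε, δ > 0 and γ > 1. Let ρ₀ : [0,M] → ℝ be continuous, positive on [0,M), with ρ₀(M) = 0, ∫₀^M dy/ρ₀(y) < ∞, and ρ₀ continuously differentiable on (0,M); set r₀(x) = ((3/(4π)) ∫₀^x dy/ρ₀(y))^{1/3} and P₀ = K ρ₀^γ, and assume the steady-state relation ∂_x P₀(x) = −x/(4π r₀(x)⁴) on (0,M). Let φ : [0,M] × [0,∞) → ℝ have jointly continuous partial derivatives ∂_x φ, ∂_x² φ, ∂_t φ, ∂_t² φ, ∂_x ∂_t φ, ∂_x² ∂_t φ, satisfy φ(0,t) = 0 for all t, the equation −∂_t² φ/(16π² r₀⁴) = (∂_x P₀/(π r₀³)) φ − ∂_x[ (4ε/3 + δ) ρ₀ ∂_x ∂_t φ + γ P₀ ρ₀ ∂_x φ ] on (0,M) × (0,∞), and the boundary condition (4ε/3)(4π r₀³ ρ₀ ∂_x(φ/r₀³)) + δ (4π ρ₀ ∂_x φ) = 0 at x = M for all t ≥ 0. Then for all t: d/dt ∫₀^M |∂_t φ|²/(32π² r₀⁴) dx + ∫₀^M [ δ ρ₀ |∂_x ∂_t φ|² + (4ε/3)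 ρ₀ | r₀³ ∂_x( ∂_t φ / r₀³ ) |² ] dx = −d/dt ∫₀^M [ (γ P₀ ρ₀ / 2) |∂_x φ|² + (∂_x P₀/(2π r₀³)) |φ|² ] dx. -/

import Mathlib

open Real MeasureTheory Set

theorem hasDerivWithinAt_setIntegral_of_dominated {I : Set ℝ} (hI : MeasurableSet I)
    {f f' : ℝ → ℝ → ℝ} {b : ℝ → ℝ} {t T : ℝ} (ht : 0 ≤ t) (hT : t < T)
    (hint : ∀ s ∈ Icc 0 T, IntegrableOn (fun x => f x s) I) (hb : IntegrableOn b I)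
    (hbd : ∀ x ∈ I, ∀ s ∈ Icc 0 T, |f' x s| ≤ b x)
    (hd : ∀ x ∈ I, ∀ s ∈ Icc 0 T, HasDerivWithinAt (f x) (f' x s) (Icc 0 T) s) :
    HasDerivWithinAt (fun s => ∫ x in I, f x s) (∫ x in I, f' x t) (Ici 0) t := by
  have htm : t ∈ Icc 0 T := ⟨ht, hT.le⟩
  have key : HasDerivWithinAt (fun s => ∫ x in I, f x s) (∫ x in I, f' x t) (Icc 0 T) t := by
    rw [hasDerivWithinAt_iff_tendsto_slope]
    have hev : ∀ᶠ s in nhdsWithin t (Icc 0 T \ {t}), s ∈ Icc 0 T \ {t} :=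
      eventually_mem_nhdsWithin
    have hlim : Filter.Tendsto (fun s => ∫ x in I, slope (f x) t s)
        (nhdsWithin t (Icc 0 T \ {t})) (nhds (∫ x in I, f' x t)) := by
      refine tendsto_integral_filter_of_dominated_convergence b ?_ ?_ hb ?_
      · filter_upwards [hev] with s hs
        simp only [slope_def_field]
        exact (((hint s hs.1).sub (hint t htm)).div_const _).aestronglyMeasurable
      · filter_upwards [hev] with s hs
        filter_upwards [ae_restrict_mem hI] with x hx
        have h := (convex_Icc (0:ℝ) T).norm_image_sub_le_of_norm_hasDerivWithin_le
          (hd x hx) (fun u hu => by simpa using hbd x hx u hu) htm hs.1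
        have hne : 0 < ‖s - t‖ := norm_pos_iff.2 (sub_ne_zero.2 hs.2)
        rw [slope_def_field, norm_div]
        exact (div_le_iff₀ hne).2 h
      · filter_upwards [ae_restrict_mem hI] with x hx
        exact hasDerivWithinAt_iff_tendsto_slope.1 (hd x hx t htm)
    refine hlim.congr' ?_
    filter_upwards [hev] with s hs
    simp only [slope_def_field]
    rw [integral_div, integral_sub (hint s hs.1) (hint t htm)]
  refine key.mono_of_mem_nhdsWithin ?_
  rw [mem_nhdsWithin]
  exact ⟨Iio T, isOpen_Iio, hT, fun s hs => ⟨hs.2, hs.1.le⟩⟩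

theorem not_bounded_of_deriv_le_neg_div {F F' : ℝ → ℝ} {a k B : ℝ} (ha : 0 < a) (hk : 0 < k)
    (hF : ∀ x ∈ Ioo 0 a, HasDerivAt F (F' x) x) (hF' : ∀ x ∈ Ioo 0 a, F' x ≤ -k / x)
    (hB : ∀ x ∈ Ioo 0 a, |F x| ≤ B) : False := by
  have hH : ∀ x ∈ Ioo 0 a, HasDerivAt (fun x => F x + k * log x) (F' x + k * x⁻¹) x :=
    fun x hx => (hF x hx).add ((hasDerivAt_log hx.1.ne').const_mul k)
  have hanti : AntitoneOn (fun x => F x + k * log x) (Ioo 0 a) := by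
    refine antitoneOn_of_deriv_nonpos (convex_Ioo _ _)
      (fun x hx => (hH x hx).continuousAt.continuousWithinAt)
      (fun x hx => ((hH x (interior_subset hx)).differentiableAt).differentiableWithinAt) ?_
    intro x hx
    rw [interior_Ioo] at hx
    rw [(hH x hx).deriv]
    have := hF' x hx
    rw [div_eq_mul_inv] at this
    linarith
  have hlog := (tendsto_log_nhdsGT_zero.const_mul_atBot hk).eventually_lt_atBot
    (-2 * B + k * log (a / 2))
  have hmem : ∀ᶠ x in nhdsWithin (0:ℝ) (Ioi 0), x ∈ Ioo 0 (a / 2) :=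
    Ioo_mem_nhdsGT (half_pos ha)
  obtain ⟨x, hx1, hx⟩ := (hlog.and hmem).exists
  have hxa : x ∈ Ioo 0 a := ⟨hx.1, by linarith [hx.2]⟩
  have hha : a / 2 ∈ Ioo 0 a := ⟨by linarith, by linarith⟩
  have h := hanti hxa hha hx.2.le
  have h1 := abs_le.1 (hB x hxa)
  have h2 := abs_le.1 (hB _ hha)
  simp only at h
  linarith [h1.1, h1.2, h2.1, h2.2]

theorem hasDerivWithinAt_partial_comm {M : ℝ} {φ φx φt φxt : ℝ → ℝ → ℝ}
    (hdx : ∀ t ∈ Ici (0:ℝ), ∀ x ∈ Ioo (0:ℝ) M, HasDerivAt (fun y => φ y t) (φx x t) x)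
    (hdt : ∀ x ∈ Icc (0:ℝ) M, ∀ t ∈ Ici (0:ℝ),
      HasDerivWithinAt (fun s => φ x s) (φt x t) (Ici 0) t)
    (hdxt : ∀ t ∈ Ici (0:ℝ), ∀ x ∈ Ioo (0:ℝ) M,
      HasDerivAt (fun y => φt y t) (φxt x t) x)
    (hjc2 : ContinuousOn (fun p : ℝ × ℝ => φt p.1 p.2) (Icc 0 M ×ˢ Ici 0))
    (hjc4 : ContinuousOn (fun p : ℝ × ℝ => φxt p.1 p.2) (Icc 0 M ×ˢ Ici 0))
    {x : ℝ} (hx : x ∈ Ioo (0:ℝ) M) {t : ℝ} (ht : t ∈ Ici (0:ℝ)) :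
    HasDerivWithinAt (fun s => φx x s) (φxt x t) (Ici 0) t := by
  have slice : ∀ {g : ℝ → ℝ → ℝ}, ContinuousOn (fun p : ℝ × ℝ => g p.1 p.2) (Icc 0 M ×ˢ Ici 0) →
      ∀ y ∈ Icc (0:ℝ) M, ContinuousOn (g y) (Ici 0) := fun hg y hy =>
    hg.comp (f := fun s => (y, s)) (by fun_prop) (fun s hs => ⟨hy, hs⟩)
  have hIoo : Ioo (0:ℝ) M ∈ nhds x := Ioo_mem_nhds hx.1 hx.2
  have hsub : ∀ {s : ℝ}, 0 ≤ s → uIcc 0 s ⊆ Ici (0:ℝ) := fun hs => by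
    rw [uIcc_of_le hs]; exact Icc_subset_Ici_self
  have repr : ∀ s ∈ Ici (0:ℝ), φx x s = φx x 0 + ∫ u in (0:ℝ)..s, φxt x u := by
    intro s hs
    have h0 : (0:ℝ) ≤ s := hs
    obtain ⟨B, hB⟩ := ((isCompact_Icc (a := (0:ℝ)) (b := M)).prod
      (isCompact_Icc (a := (0:ℝ)) (b := s))).exists_bound_of_continuousOn
      (hjc4.mono (prod_mono subset_rfl Icc_subset_Ici_self))
    have hFTC : ∀ y ∈ Ioo (0:ℝ) M, ∫ u in (0:ℝ)..s, φt y u = φ y s - φ y 0 := by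
      intro y hy
      refine intervalIntegral.integral_eq_sub_of_hasDeriv_right_of_le h0 ?_ ?_ ?_
      · exact fun u hu => ((hdt y (Ioo_subset_Icc_self hy) u hu.1).continuousWithinAt).mono
          Icc_subset_Ici_self
      · exact fun u hu => (hdt y (Ioo_subset_Icc_self hy) u hu.1.le).mono
          (fun v hv => (hu.1.trans hv).le)
      · exact ((slice hjc2 y (Ioo_subset_Icc_self hy)).mono (hsub h0)).intervalIntegrable
    have hder := (intervalIntegral.hasDerivAt_integral_of_dominated_loc_of_deriv_le
      (μ := volume) (a := (0:ℝ)) (b := s) (F := fun y u => φt y u) (F' := fun y u => φxt y u)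
      (x₀ := x) (s := Ioo (0:ℝ) M) (bound := fun _ => B) hIoo
      (by
        filter_upwards [hIoo] with y hy
        exact ((slice hjc2 y (Ioo_subset_Icc_self hy)).mono
          (hsub h0)).intervalIntegrable.def'.aestronglyMeasurable)
      ((slice hjc2 x (Ioo_subset_Icc_self hx)).mono (hsub h0)).intervalIntegrable
      ((slice hjc4 x (Ioo_subset_Icc_self hx)).mono
          (hsub h0)).intervalIntegrable.def'.aestronglyMeasurable
      (by
        refine Filter.Eventually.of_forall fun u hu y hy => ?_
        rw [uIoc_of_le h0] at hu
        exact hB (y, u) ⟨Ioo_subset_Icc_self hy, hu.1.le, hu.2⟩)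
      intervalIntegrable_const
      (by
        refine Filter.Eventually.of_forall fun u hu y hy => ?_
        rw [uIoc_of_le h0] at hu
        exact hdxt u hu.1.le y hy)).2
    have hder' : HasDerivAt (fun y => ∫ u in (0:ℝ)..s, φt y u) (φx x s - φx x 0) x := by
      refine ((hdx s hs x hx).sub (hdx 0 self_mem_Ici x hx)).congr_of_eventuallyEq ?_
      filter_upwards [hIoo] with y hy
      simp [hFTC y hy]
    linarith [hder.unique hder']
  have hc := slice hjc4 x (Ioo_subset_Icc_self hx)
  have hmain : HasDerivWithinAt (fun s => ∫ u in (0:ℝ)..s, φxt x u) (φxt x t) (Ici 0) t := by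
    have h0 : (0:ℝ) ≤ t := ht
    have hcc : ContinuousOn (φxt x) (Icc 0 (t + 1)) := hc.mono Icc_subset_Ici_self
    have htm : t ∈ Icc (0:ℝ) (t + 1) := ⟨h0, by linarith⟩
    have : Fact (t ∈ Icc (0:ℝ) (t + 1)) := ⟨htm⟩
    have := intervalIntegral.integral_hasDerivWithinAt_right (s := Icc 0 (t + 1))
      (t := Icc 0 (t + 1)) (a := 0) (b := t) (f := φxt x)
      (hc.mono (hsub h0)).intervalIntegrable
      (hcc.stronglyMeasurableAtFilter_nhdsWithin measurableSet_Icc t) (hcc t htm)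
    refine this.mono_of_mem_nhdsWithin ?_
    rw [mem_nhdsWithin]
    exact ⟨Iio (t + 1), isOpen_Iio, by simp, fun s hs => ⟨hs.2, hs.1.le⟩⟩
  exact (hmain.const_add (φx x 0)).congr repr (repr t ht)

theorem integrableOn_Ioo_of_continuousOn_of_abs_le {f g : ℝ → ℝ} {a b : ℝ}
    (hf : ContinuousOn f (Ioo a b)) (hg : IntegrableOn g (Ioo a b))
    (hfg : ∀ x ∈ Ioo a b, |f x| ≤ g x) : IntegrableOn f (Ioo a b) := by
  refine Integrable.mono' hg (hf.aestronglyMeasurable measurableSet_Ioo) ?_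
  filter_upwards [ae_restrict_mem measurableSet_Ioo] with x hx
  exact hfg x hx

section Radius

variable {M : ℝ} {ρ₀ r₀ : ℝ → ℝ} (hM : 0 < M) (hρcont : ContinuousOn ρ₀ (Icc 0 M))
  (hρpos : ∀ x ∈ Ico (0:ℝ) M, 0 < ρ₀ x)
  (hρint : IntegrableOn (fun y => 1/ρ₀ y) (Ioc 0 M))
  (hr₀ : ∀ x, r₀ x = ((3/(4*π)) * ∫ y in (0:ℝ)..x, 1/ρ₀ y) ^ ((1:ℝ)/3))

include hρint in
theorem intervalIntegrable_inv_density {x : ℝ} (hx : x ∈ Icc 0 M) :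
    IntervalIntegrable (fun y => 1/ρ₀ y) volume 0 x :=
  (intervalIntegrable_iff_integrableOn_Ioc_of_le hx.1).2 (hρint.mono_set (Ioc_subset_Ioc_right hx.2))

include hρpos in
theorem mass_integral_nonneg {x : ℝ} (hx : x ∈ Icc 0 M) : 0 ≤ ∫ y in (0:ℝ)..x, 1/ρ₀ y := by
  rw [intervalIntegral.integral_of_le hx.1, integral_Ioc_eq_integral_Ioo]
  refine setIntegral_nonneg measurableSet_Ioo fun y hy => ?_
  exact (one_div_pos.2 (hρpos y ⟨hy.1.le, hy.2.trans_le hx.2⟩)).le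

include hρpos hr₀ in
theorem radius_cube {x : ℝ} (hx : x ∈ Icc 0 M) :
    r₀ x ^ 3 = (3/(4*π)) * ∫ y in (0:ℝ)..x, 1/ρ₀ y := by
  have h0 := mass_integral_nonneg hρpos hx
  rw [hr₀, ← rpow_natCast, ← rpow_mul (by positivity)]
  norm_num

include hρpos hr₀ in
theorem radius_nonneg {x : ℝ} (hx : x ∈ Icc 0 M) : 0 ≤ r₀ x := by
  have h0 := mass_integral_nonneg hρpos hx
  rw [hr₀]; positivity

include hM hρcont hρpos hρint hr₀ in
theorem exists_le_mul_radius_cube : ∃ C > 0, ∀ x ∈ Icc 0 M, x ≤ C * r₀ x ^ 3 := by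
  obtain ⟨R, hR⟩ := isCompact_Icc.exists_bound_of_continuousOn hρcont
  have hRpos : 0 < R := by
    have h0 := hR 0 ⟨le_rfl, hM.le⟩
    exact (abs_pos.2 (hρpos 0 ⟨le_rfl, hM⟩).ne').trans_le h0
  refine ⟨4 * π * R / 3, by positivity, fun x hx => ?_⟩
  rw [radius_cube hρpos hr₀ hx]
  have h := intervalIntegral.integral_mono_on_of_le_Ioo (μ := volume) hx.1
    (f := fun _ => 1 / R) (g := fun y => 1/ρ₀ y) intervalIntegrable_const
    (intervalIntegrable_inv_density hρint hx) (fun y hy => by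
      have hy' : y ∈ Ico 0 M := ⟨hy.1.le, hy.2.trans_le hx.2⟩
      exact one_div_le_one_div_of_le (hρpos y hy')
        ((le_abs_self _).trans (hR y (Ico_subset_Icc_self hy'))))
  simp only [intervalIntegral.integral_const, sub_zero, smul_eq_mul] at h
  calc x = R * (x * (1 / R)) := by field_simp
    _ ≤ R * ∫ y in (0:ℝ)..x, 1/ρ₀ y := by gcongr
    _ = _ := by field_simp

include hM hρcont hρpos hρint hr₀ in
theorem radius_pos {x : ℝ} (hx : x ∈ Ioc 0 M) : 0 < r₀ x := by
  obtain ⟨C, hC, h⟩ := exists_le_mul_radius_cube hM hρcont hρpos hρint hr₀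
  have hx' := Ioc_subset_Icc_self hx
  refine lt_of_le_of_ne (radius_nonneg hρpos hr₀ hx') fun h0 => ?_
  have := h x hx'
  rw [← h0] at this
  linarith [hx.1]

include hM hρcont hρpos hρint hr₀ in
theorem exists_radius_cube_le : ∃ C > 0, ∀ x ∈ Icc 0 (M/2), r₀ x ^ 3 ≤ C * x := by
  have hsub : Icc 0 (M/2) ⊆ Ico 0 M := fun x hx => ⟨hx.1, by linarith [hx.2]⟩
  have hcont : ContinuousOn (fun y => 1/ρ₀ y) (Icc 0 (M/2)) :=
    continuousOn_const.div (hρcont.mono (hsub.trans Ico_subset_Icc_self))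
      fun y hy => (hρpos y (hsub hy)).ne'
  obtain ⟨R, hR⟩ := isCompact_Icc.exists_bound_of_continuousOn hcont
  have hRpos : 0 < R := (norm_pos_iff.2 (one_div_pos.2
    (hρpos 0 ⟨le_rfl, hM⟩)).ne').trans_le (hR 0 ⟨le_rfl, by linarith⟩)
  refine ⟨3 / (4 * π) * R, by positivity, fun x hx => ?_⟩
  have hxM : x ∈ Icc 0 M := Ico_subset_Icc_self (hsub hx)
  rw [radius_cube hρpos hr₀ hxM, mul_assoc]
  have h := intervalIntegral.integral_mono_on (μ := volume) hx.1
    (g := fun _ => R) (f := fun y => 1/ρ₀ y)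
    (intervalIntegrable_inv_density hρint hxM) intervalIntegrable_const
    (fun y hy => (le_abs_self _).trans (hR y ⟨hy.1, hy.2.trans hx.2⟩))
  simp only [intervalIntegral.integral_const, sub_zero, smul_eq_mul] at h
  gcongr
  linarith

include hM hρint hr₀ in
theorem continuousOn_radius : ContinuousOn r₀ (Icc 0 M) := by
  have h : ContinuousOn (fun x => ∫ y in (0:ℝ)..x, 1/ρ₀ y) (Icc 0 M) := by
    have := intervalIntegral.continuousOn_primitive_interval (μ := volume) (a := 0) (b := M)
      (f := fun y => 1/ρ₀ y) (by
        rw [uIcc_of_le hM.le, integrableOn_Icc_iff_integrableOn_Ioc]; exact hρint)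
    rwa [uIcc_of_le hM.le] at this
  have h2 : r₀ = fun x => ((3/(4*π)) * ∫ y in (0:ℝ)..x, 1/ρ₀ y) ^ ((1:ℝ)/3) := funext hr₀
  rw [h2]
  exact (continuousOn_const.mul h).rpow_const fun _ _ => Or.inr (by norm_num)

include hρcont hρpos hρint hr₀ in
theorem hasDerivAt_radius_cube {x : ℝ} (hx : x ∈ Ioo 0 M) :
    HasDerivAt (fun y => r₀ y ^ 3) (3 / (4 * π * ρ₀ x)) x := by
  have hcont : ContinuousOn (fun y => 1/ρ₀ y) (Ioo 0 M) :=
    continuousOn_const.div (hρcont.mono Ioo_subset_Icc_self)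
      fun y hy => (hρpos y (Ioo_subset_Ico_self hy)).ne'
  have h := (intervalIntegral.integral_hasDerivAt_right
    (intervalIntegrable_inv_density hρint (Ioo_subset_Icc_self hx))
    (hcont.stronglyMeasurableAtFilter isOpen_Ioo x hx)
    (hcont.continuousAt (isOpen_Ioo.mem_nhds hx))).const_mul (3 / (4 * π))
  have hne := (hρpos x (Ioo_subset_Ico_self hx)).ne'
  have he : 3 / (4 * π) * (1 / ρ₀ x) = 3 / (4 * π * ρ₀ x) := by field_simp
  rw [he] at h
  refine h.congr_of_eventuallyEq ?_
  filter_upwards [isOpen_Ioo.mem_nhds hx] with y hy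
  exact radius_cube hρpos hr₀ (Ioo_subset_Icc_self hy)

include hM hρcont hρpos hρint hr₀ in
theorem integrableOn_inv_radius : IntegrableOn (fun x => 1 / r₀ x) (Ioo 0 M) := by
  obtain ⟨C, hC, h⟩ := exists_le_mul_radius_cube hM hρcont hρpos hρint hr₀
  have hpos : ∀ x ∈ Ioo 0 M, 0 < r₀ x := fun x hx =>
    radius_pos hM hρcont hρpos hρint hr₀ (Ioo_subset_Ioc_self hx)
  refine integrableOn_Ioo_of_continuousOn_of_abs_le
    (g := fun x => C ^ ((1:ℝ)/3) * x ^ (-(1:ℝ)/3)) ?_ ?_ fun x hx => ?_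
  · exact continuousOn_const.div ((continuousOn_radius hM hρint hr₀).mono Ioo_subset_Icc_self)
      fun x hx => (hpos x hx).ne'
  · have := (intervalIntegral.intervalIntegrable_rpow' (a := 0) (b := M)
      (r := -(1:ℝ)/3) (by norm_num)).const_mul (C ^ ((1:ℝ)/3))
    exact ((intervalIntegrable_iff_integrableOn_Ioc_of_le hM.le).1 this).mono_set
      Ioo_subset_Ioc_self
  · have hr := hpos x hx
    have hx0 := hx.1
    rw [abs_of_pos (one_div_pos.2 hr), neg_div, rpow_neg hx0.le, ← div_eq_mul_inv,
      div_le_div_iff₀ hr (by positivity), one_mul]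
    calc x ^ ((1:ℝ)/3) ≤ (C * r₀ x ^ 3) ^ ((1:ℝ)/3) := by
          gcongr; exact h x (Ioo_subset_Icc_self hx)
      _ = C ^ ((1:ℝ)/3) * r₀ x := by
          rw [mul_rpow hC.le (by positivity), ← rpow_natCast, ← rpow_mul hr.le]
          norm_num

end Radius

theorem abs_le_mul_of_bounded_flux {M B B' C R : ℝ} (hM : 0 < M) (hB : 0 ≤ B)
    (hC : 0 < C) (hR : 0 < R)
    {r φ φx φtt F G : ℝ → ℝ}
    (hrpos : ∀ x ∈ Ioo 0 M, 0 < r x) (hrR : ∀ x ∈ Ioo 0 M, r x ≤ R)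
    (hrC : ∀ x ∈ Icc 0 (M/2), r x ^ 3 ≤ C * x)
    (hφ : ∀ x ∈ Ioo 0 M, HasDerivAt φ (φx x) x) (hφx : ∀ x ∈ Ioo 0 M, |φx x| ≤ B)
    (hφtt : ContinuousOn φtt (Icc 0 M)) (hφtt0 : φtt 0 = 0)
    (hF : ∀ x ∈ Ioo 0 M, HasDerivAt F (G x) x) (hFB : ∀ x ∈ Ioo 0 M, |F x| ≤ B')
    (heq : ∀ x ∈ Ioo 0 M,
      -(φtt x)/(16*π^2*(r x)^4) = ((-x/(4*π*(r x)^4))/(π*(r x)^3)) * φ x - G x) :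
    ∀ x ∈ Ioo 0 M, |φ x| ≤ B * x := by
  have hlip : LipschitzOnWith ⟨B, hB⟩ φ (Ioo 0 M) :=
    (convex_Ioo 0 M).lipschitzOnWith_of_nnnorm_hasDerivWithin_le
      (fun x hx => (hφ x hx).hasDerivWithinAt) (fun x hx => hφx x hx)
  obtain ⟨g, hg, hgφ⟩ := hlip.extend_real
  suffices h0 : g 0 = 0 by
    intro x hx
    have h := hg.dist_le_mul x 0
    rw [h0, ← hgφ hx, Real.dist_eq, Real.dist_eq, sub_zero, sub_zero, abs_of_pos hx.1] at h
    exact h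
  by_contra hc
  set c := g 0 with hcdef
  have hc2 : 0 < c ^ 2 := by positivity
  have hg_lim : Filter.Tendsto (fun x => c * g x) (nhdsWithin 0 (Ioi 0)) (nhds (c * c)) :=
    ((hg.continuous.tendsto 0).mono_left nhdsWithin_le_nhds).const_mul c
  have htt_lim : Filter.Tendsto (fun x => c * φtt x) (nhdsWithin 0 (Ioi 0)) (nhds (c * 0)) := by
    have h := hφtt 0 ⟨le_rfl, hM.le⟩
    rw [ContinuousWithinAt, hφtt0] at h
    refine (h.mono_left ?_).const_mul c
    rw [← nhdsWithin_Ioo_eq_nhdsGT hM]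
    exact nhdsWithin_mono _ Ioo_subset_Icc_self
  have h1 := hg_lim.eventually_const_lt (show c ^ 2 / 2 < c * c by nlinarith)
  have h2 := htt_lim.eventually_lt_const (show c * 0 < c ^ 2 / C by rw [mul_zero]; positivity)
  have h3 : ∀ᶠ x in nhdsWithin (0:ℝ) (Ioi 0), x ∈ Ioo 0 (M/2) := Ioo_mem_nhdsGT (half_pos hM)
  obtain ⟨a, ha, hev⟩ := mem_nhdsGT_iff_exists_Ioo_subset.1 ((h1.and h2).and h3)
  have hsub : ∀ x ∈ Ioo 0 a, x ∈ Ioo 0 M := fun x hx =>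
    ⟨hx.1, (hev hx).2.2.trans (by linarith)⟩
  refine not_bounded_of_deriv_le_neg_div (F := fun x => c * F x) (F' := fun x => c * G x)
    (a := a) (k := c ^ 2 / (16 * π ^ 2 * C ^ 2 * R)) (B := |c| * B') ha (by positivity)
    (fun x hx => (hF x (hsub x hx)).const_mul c) (fun x hx => ?_)
    (fun x hx => by
      rw [abs_mul]; exact mul_le_mul_of_nonneg_left (hFB x (hsub x hx)) (abs_nonneg _))
  have hxM := hsub x hx
  have hx0 : 0 < x := hx.1
  obtain ⟨⟨hgx, httx⟩, hxh⟩ := hev hx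
  rw [← hgφ hxM] at hgx
  have hr := hrpos x hxM
  have hr3 := hrC x (Ioo_subset_Icc_self hxh)
  have hG : c * G x = -((c * φ x * (x / r x ^ 3) / (4 * π ^ 2) - c * φtt x / (16 * π ^ 2))
      / r x ^ 4) := by
    have h := heq x hxM
    have : G x = ((-x/(4*π*(r x)^4))/(π*(r x)^3)) * φ x + (φtt x)/(16*π^2*(r x)^4) := by
      rw [neg_div] at h; linarith
    rw [this]; field_simp; ring
  have hq : 1 / C ≤ x / r x ^ 3 := by
    rw [div_le_div_iff₀ hC (by positivity)]; linarith
  have hA : c ^ 2 / (16 * π ^ 2 * C) ≤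
      c * φ x * (x / r x ^ 3) / (4 * π ^ 2) - c * φtt x / (16 * π ^ 2) := by
    have hcφ : 0 ≤ c * φ x := (half_pos hc2).le.trans hgx.le
    have e1 : c ^ 2 / 2 * (1 / C) / (4 * π ^ 2) ≤ c * φ x * (x / r x ^ 3) / (4 * π ^ 2) := by
      gcongr
    have e2 : c * φtt x / (16 * π ^ 2) ≤ c ^ 2 / C / (16 * π ^ 2) := by gcongr
    have e3 : c ^ 2 / 2 * (1 / C) / (4 * π ^ 2) - c ^ 2 / C / (16 * π ^ 2)
        = c ^ 2 / (16 * π ^ 2 * C) := by field_simp; ring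
    linarith
  have hr4 : r x ^ 4 ≤ C * x * R := by
    calc r x ^ 4 = r x ^ 3 * r x := by ring
      _ ≤ C * x * R := by
        have := hrR x hxM
        gcongr
  have hfin : c ^ 2 / (16 * π ^ 2 * C) / (C * x * R) ≤
      (c * φ x * (x / r x ^ 3) / (4 * π ^ 2) - c * φtt x / (16 * π ^ 2)) / r x ^ 4 := by
    have : 0 ≤ c ^ 2 / (16 * π ^ 2 * C) := by positivity
    gcongr
    linarith
  have he : -(c ^ 2 / (16 * π ^ 2 * C ^ 2 * R)) / x
      = -(c ^ 2 / (16 * π ^ 2 * C) / (C * x * R)) := by field_simp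
  rw [he, hG]
  linarith

theorem abs_mul_div_pow_four_le {x r C a b A B : ℝ} (hr : 0 < r) (hA : 0 ≤ A)
    (hx : x ≤ C * r ^ 3) (ha : |a| ≤ A * x) (hb : |b| ≤ B) :
    |a * b / r ^ 4| ≤ A * B * C * (1 / r) := by
  have hB : 0 ≤ B := (abs_nonneg b).trans hb
  rw [abs_div, abs_mul, abs_of_pos (pow_pos hr 4), div_le_iff₀ (by positivity)]
  calc |a| * |b| ≤ (A * (C * r ^ 3)) * B := by
        have h := ha.trans (mul_le_mul_of_nonneg_left hx hA)
        exact mul_le_mul h hb (abs_nonneg b) ((abs_nonneg a).trans h)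
    _ = _ := by field_simp

theorem continuousOn_sq_div_of_abs_le {M B C : ℝ} {f S : ℝ → ℝ}
    (hf : ContinuousOn f (Icc 0 M)) (hS : ContinuousOn S (Icc 0 M))
    (hSpos : ∀ x ∈ Ioc 0 M, 0 < S x)
    (hfB : ∀ x ∈ Icc 0 M, |f x| ≤ B * x) (hSC : ∀ x ∈ Icc 0 M, x ≤ C * S x) :
    ContinuousOn (fun x => f x ^ 2 / S x) (Icc 0 M) := by
  intro x hx
  rcases hx.1.eq_or_lt with h0 | h0
  · subst h0
    have hf0 : f 0 = 0 := by simpa using hfB 0 hx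
    rw [ContinuousWithinAt, hf0]
    simp only [ne_eq, OfNat.ofNat_ne_zero, not_false_eq_true, zero_pow, zero_div]
    refine squeeze_zero_norm' (a := fun x => B ^ 2 * C * x) ?_ ?_
    · filter_upwards [self_mem_nhdsWithin] with y hy
      rcases hy.1.eq_or_lt with hy0 | hy0
      · subst hy0; simp [hf0]
      · have hSy := hSpos y ⟨hy0, hy.2⟩
        rw [Real.norm_eq_abs, abs_div, abs_of_pos hSy, div_le_iff₀ hSy, abs_pow]
        calc |f y| ^ 2 ≤ (B * y) ^ 2 := by gcongr; exact hfB y hy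
          _ = B ^ 2 * y * y := by ring
          _ ≤ B ^ 2 * y * (C * S y) := by gcongr; exact hSC y hy
          _ = _ := by ring
    · have : Filter.Tendsto (fun x : ℝ => B ^ 2 * C * x) (nhds 0) (nhds (B ^ 2 * C * 0)) :=
        (continuous_const.mul continuous_id).tendsto 0
      rw [mul_zero] at this
      exact this.mono_left nhdsWithin_le_nhds
  · exact ((hf x hx).pow 2).div (hS x hx) (hSpos x ⟨h0, hx.2⟩).ne'

/-- Energy evolution identity for the second-order formulation of the linearized
Navier–Stokes–Poisson system around a Lane–Emden star in Lagrangian mass coordinates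
`x ∈ [0,M]`: if `φ` solves
`-∂_t²φ/(16π²r₀⁴) = (∂_xP₀/(πr₀³))φ - ∂_x[(4ε/3+δ)ρ₀ ∂_x∂_tφ + γP₀ρ₀ ∂_xφ]`
with `φ(0,t) = 0` and the homogeneous normal-stress boundary condition at `x = M`
(with `4π r₀³ρ₀ ∂_x(f/r₀³) = 4πρ₀ ∂_x f - 3f/r₀³`), then
`d/dt ∫ |∂_tφ|²/(32π²r₀⁴) + ∫ [δρ₀|∂_x∂_tφ|² + (4ε/3)ρ₀|r₀³∂_x(∂_tφ/r₀³)|²]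
 = -d/dt ∫ [(γP₀ρ₀/2)|∂_xφ|² + (∂_xP₀/(2πr₀³))|φ|²]`,
where `r₀³∂_x(f/r₀³) = ∂_x f - 3f/(4πρ₀r₀³)`. -/
theorem stmt14 (M K ε δ γ : ℝ) (hM : 0 < M) (hK : 0 < K) (hε : 0 < ε) (hδ : 0 < δ)
    (hγ : 1 < γ)
    (ρ₀ : ℝ → ℝ)
    (hρcont : ContinuousOn ρ₀ (Icc 0 M))
    (hρpos : ∀ x ∈ Ico (0:ℝ) M, 0 < ρ₀ x)
    (hρM : ρ₀ M = 0)
    (hρint : IntegrableOn (fun y => 1/ρ₀ y) (Ioc 0 M))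
    (hρC1 : ContDiffOn ℝ 1 ρ₀ (Ioo 0 M))
    (r₀ P₀ : ℝ → ℝ)
    (hr₀ : ∀ x, r₀ x = ((3/(4*π)) * ∫ y in (0:ℝ)..x, 1/ρ₀ y) ^ ((1:ℝ)/3))
    (hP₀ : ∀ x, P₀ x = K * ρ₀ x ^ γ)
    (hsteady : ∀ x ∈ Ioo (0:ℝ) M, deriv P₀ x = -x/(4*π*(r₀ x)^4))
    (φ φx φt φtt φxt : ℝ → ℝ → ℝ)
    (hdx : ∀ t ∈ Ici (0:ℝ), ∀ x ∈ Ioo (0:ℝ) M, HasDerivAt (fun y => φ y t) (φx x t) x)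
    (hdt : ∀ x ∈ Icc (0:ℝ) M, ∀ t ∈ Ici (0:ℝ),
      HasDerivWithinAt (fun s => φ x s) (φt x t) (Ici 0) t)
    (hdtt : ∀ x ∈ Icc (0:ℝ) M, ∀ t ∈ Ici (0:ℝ),
      HasDerivWithinAt (fun s => φt x s) (φtt x t) (Ici 0) t)
    (hdxt : ∀ t ∈ Ici (0:ℝ), ∀ x ∈ Ioo (0:ℝ) M,
      HasDerivAt (fun y => φt y t) (φxt x t) x)
    (hjc1 : ContinuousOn (fun p : ℝ × ℝ => φx p.1 p.2) (Icc 0 M ×ˢ Ici 0))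
    (hjc2 : ContinuousOn (fun p : ℝ × ℝ => φt p.1 p.2) (Icc 0 M ×ˢ Ici 0))
    (hjc3 : ContinuousOn (fun p : ℝ × ℝ => φtt p.1 p.2) (Icc 0 M ×ˢ Ici 0))
    (hjc4 : ContinuousOn (fun p : ℝ × ℝ => φxt p.1 p.2) (Icc 0 M ×ˢ Ici 0))
    (hbc0 : ∀ t ∈ Ici (0:ℝ), φ 0 t = 0)
    (G : ℝ → ℝ → ℝ)
    (hG : ∀ t ∈ Ici (0:ℝ), ∀ x ∈ Ioo (0:ℝ) M,
      HasDerivAt (fun y => (4*ε/3 + δ) * ρ₀ y * φxt y t + γ * P₀ y * ρ₀ y * φx y t)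
        (G x t) x)
    (heq : ∀ t ∈ Ici (0:ℝ), ∀ x ∈ Ioo (0:ℝ) M,
      -(φtt x t)/(16*π^2*(r₀ x)^4) = (deriv P₀ x/(π*(r₀ x)^3)) * φ x t - G x t)
    (hbcM : ∀ t ∈ Ici (0:ℝ),
      (4*ε/3) * (4*π*ρ₀ M*φx M t - 3*φ M t/(r₀ M)^3) + δ * (4*π*ρ₀ M*φx M t) = 0) :
    ∀ t ∈ Ici (0:ℝ), ∃ d₁ d₂ : ℝ,
      HasDerivWithinAt
        (fun s => ∫ x in Ioo (0:ℝ) M, (φt x s)^2/(32*π^2*(r₀ x)^4)) d₁ (Ici 0) t ∧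
      HasDerivWithinAt
        (fun s => ∫ x in Ioo (0:ℝ) M,
          ((γ * P₀ x * ρ₀ x/2) * (φx x s)^2
            + (deriv P₀ x/(2*π*(r₀ x)^3)) * (φ x s)^2)) d₂ (Ici 0) t ∧
      d₁ + (∫ x in Ioo (0:ℝ) M,
          (δ * ρ₀ x * (φxt x t)^2
            + (4*ε/3) * ρ₀ x * (φxt x t - 3*φt x t/(4*π*ρ₀ x*(r₀ x)^3))^2))
        = -d₂ := by
  intro t ht
  have ht0 : (0:ℝ) ≤ t := ht
  have hIoo : Ioo (0:ℝ) M ⊆ Icc 0 M := Ioo_subset_Icc_self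
  have htI : t ∈ Icc (0:ℝ) (t + 1) := ⟨ht0, by linarith⟩
  have hIcc : Icc (0:ℝ) (t + 1) ⊆ Ici 0 := Icc_subset_Ici_self
  have hsub : Icc (0:ℝ) M ×ˢ Icc (0:ℝ) (t + 1) ⊆ Icc 0 M ×ˢ Ici 0 :=
    prod_mono subset_rfl Icc_subset_Ici_self
  -- geometry of the star
  obtain ⟨C, hC, hxC⟩ := exists_le_mul_radius_cube hM hρcont hρpos hρint hr₀
  obtain ⟨C', hC', hxC'⟩ := exists_radius_cube_le hM hρcont hρpos hρint hr₀
  have hrpos : ∀ x ∈ Ioc 0 M, 0 < r₀ x := fun x hx => radius_pos hM hρcont hρpos hρint hr₀ hx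
  have hrpos' : ∀ x ∈ Ioo 0 M, 0 < r₀ x := fun x hx => hrpos x (Ioo_subset_Ioc_self hx)
  have hrcont := continuousOn_radius hM hρint hr₀
  have hrint := integrableOn_inv_radius hM hρcont hρpos hρint hr₀
  have hρpos' : ∀ x ∈ Ioo 0 M, 0 < ρ₀ x := fun x hx => hρpos x (Ioo_subset_Ico_self hx)
  have hPcont : ContinuousOn P₀ (Icc 0 M) := by
    rw [show P₀ = fun x => K * ρ₀ x ^ γ from funext hP₀]
    exact continuousOn_const.mul (hρcont.rpow_const fun _ _ => Or.inr (by linarith))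
  obtain ⟨R, hR⟩ := isCompact_Icc.exists_bound_of_continuousOn hrcont
  have hrR : ∀ x ∈ Ioo 0 M, r₀ x ≤ R := fun x hx => (le_abs_self _).trans (hR x (hIoo hx))
  have hRpos : 0 < R := (hrpos' (M/2) ⟨by linarith, by linarith⟩).trans_le
    (hrR (M/2) ⟨by linarith, by linarith⟩)
  obtain ⟨A, hA⟩ := isCompact_Icc.exists_bound_of_continuousOn
    (f := fun x => γ * P₀ x * ρ₀ x) ((continuousOn_const.mul hPcont).mul hρcont)
  have hA0 : 0 ≤ A := (norm_nonneg _).trans (hA 0 ⟨le_rfl, hM.le⟩)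
  simp only [Real.norm_eq_abs] at hA
  -- continuity of the time slices
  have slice : ∀ {g : ℝ → ℝ → ℝ},
      ContinuousOn (fun p : ℝ × ℝ => g p.1 p.2) (Icc 0 M ×ˢ Ici 0) →
      ∀ s ∈ Ici (0:ℝ), ContinuousOn (fun x => g x s) (Icc 0 M) := fun hg s hs =>
    hg.comp (f := fun x => (x, s)) (by fun_prop) (fun x hx => ⟨hx, hs⟩)
  -- uniform bounds on a compact time interval
  have hbound : ∃ B : ℝ, 0 ≤ B ∧ ∀ x ∈ Icc (0:ℝ) M, ∀ s ∈ Icc (0:ℝ) (t + 1),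
      |φx x s| ≤ B ∧ |φtt x s| ≤ B ∧ |φxt x s| ≤ B := by
    have hK2 := (isCompact_Icc (a := (0:ℝ)) (b := M)).prod
      (isCompact_Icc (a := (0:ℝ)) (b := t + 1))
    obtain ⟨B1, h1⟩ := hK2.exists_bound_of_continuousOn (hjc1.mono hsub)
    obtain ⟨B2, h2⟩ := hK2.exists_bound_of_continuousOn (hjc3.mono hsub)
    obtain ⟨B3, h3⟩ := hK2.exists_bound_of_continuousOn (hjc4.mono hsub)
    refine ⟨max B1 (max B2 B3), ((norm_nonneg _).trans
      (h1 (0, t) ⟨⟨le_rfl, hM.le⟩, htI⟩)).trans (le_max_left _ _), fun x hx s hs => ⟨?_, ?_, ?_⟩⟩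
    · exact (h1 (x, s) ⟨hx, hs⟩).trans (le_max_left _ _)
    · exact (h2 (x, s) ⟨hx, hs⟩).trans ((le_max_left _ _).trans (le_max_right _ _))
    · exact (h3 (x, s) ⟨hx, hs⟩).trans ((le_max_right _ _).trans (le_max_right _ _))
  obtain ⟨B, hB0, hB⟩ := hbound
  -- boundary values
  have huniq : ∀ s ∈ Ici (0:ℝ), UniqueDiffWithinAt ℝ (Ici (0:ℝ)) s := uniqueDiffOn_Ici 0
  have hzero : ∀ {f : ℝ → ℝ} {f' s : ℝ}, (∀ u ∈ Ici (0:ℝ), f u = 0) → s ∈ Ici (0:ℝ) →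
      HasDerivWithinAt f f' (Ici 0) s → f' = 0 := fun hf hs hd =>
    (huniq _ hs).eq_deriv _ hd ((hasDerivWithinAt_const _ _ (0:ℝ)).congr hf (hf _ hs))
  have h0M : (0:ℝ) ∈ Icc 0 M := ⟨le_rfl, hM.le⟩
  have hMM : M ∈ Icc 0 M := ⟨hM.le, le_rfl⟩
  have hφt0 : ∀ s ∈ Ici (0:ℝ), φt 0 s = 0 := fun s hs => hzero hbc0 hs (hdt 0 h0M s hs)
  have hφtt0 : ∀ s ∈ Ici (0:ℝ), φtt 0 s = 0 := fun s hs => hzero hφt0 hs (hdtt 0 h0M s hs)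
  have hφM : ∀ s ∈ Ici (0:ℝ), φ M s = 0 := by
    intro s hs
    have h := hbcM s hs
    have hrM := hrpos M ⟨hM, le_rfl⟩
    rw [hρM] at h
    have h' : ε * φ M s / (r₀ M) ^ 3 = 0 := by
      have : ε * φ M s / (r₀ M) ^ 3 = -(1/4) * ((4*ε/3) * (4*π*0*φx M s - 3*φ M s/(r₀ M)^3)
        + δ * (4*π*0*φx M s)) := by ring
      rw [this, h, mul_zero]
    rcases div_eq_zero_iff.1 h' with h'' | h''
    · exact (mul_eq_zero.1 h'').resolve_left hε.ne'
    · exact absurd h'' (by positivity)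
  have hφtM : φt M t = 0 := hzero hφM ht (hdt M hMM t ht)
  have hφtB : ∀ s ∈ Icc (0:ℝ) (t + 1), ∀ x ∈ Icc 0 M, |φt x s| ≤ B * x := by
    intro s hs x hx
    rcases hx.1.eq_or_lt with h0 | h0
    · subst h0; simp [hφt0 s hs.1]
    · obtain ⟨y, hy, hslope⟩ := exists_hasDerivAt_eq_slope (fun y => φt y s) (fun y => φxt y s) h0
        ((slice hjc2 s hs.1).mono (Icc_subset_Icc_right hx.2))
        (fun y hy => hdxt s hs.1 y ⟨hy.1, hy.2.trans_le hx.2⟩)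
      have hyB := (hB y ⟨hy.1.le, hy.2.le.trans hx.2⟩ s hs).2.2
      rw [hslope, hφt0 s hs.1, sub_zero, sub_zero, abs_div, abs_of_pos h0,
        div_le_iff₀ h0] at hyB
      exact hyB
  have hFcont : ∀ s ∈ Ici (0:ℝ), ContinuousOn
      (fun y => (4*ε/3 + δ) * ρ₀ y * φxt y s + γ * P₀ y * ρ₀ y * φx y s) (Icc 0 M) :=
    fun s hs => ((continuousOn_const.mul hρcont).mul (slice hjc4 s hs)).add
      (((continuousOn_const.mul hPcont).mul hρcont).mul (slice hjc1 s hs))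
  have hφB : ∀ s ∈ Icc (0:ℝ) (t + 1), ∀ x ∈ Ioo 0 M, |φ x s| ≤ B * x := by
    intro s hs
    have hs0 : s ∈ Ici (0:ℝ) := hs.1
    obtain ⟨B', hB'⟩ := isCompact_Icc.exists_bound_of_continuousOn (hFcont s hs0)
    refine abs_le_mul_of_bounded_flux hM hB0 hC' hRpos hrpos' hrR hxC' (hdx s hs0)
      (fun x hx => (hB x (hIoo hx) s hs).1) (slice hjc3 s hs0) (hφtt0 s hs0)
      (hG s hs0) (fun x hx => hB' x (hIoo hx)) (fun x hx => ?_)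
    rw [← hsteady x hx]
    exact heq s hs0 x hx
  have hφcont : ∀ s ∈ Ici (0:ℝ), ContinuousOn (fun x => φ x s) (Ioo 0 M) := fun s hs x hx =>
    (hdx s hs x hx).continuousAt.continuousWithinAt
  -- weighted pointwise bounds
  have hkin : ∀ x ∈ Ioo 0 M, ∀ s ∈ Icc (0:ℝ) (t + 1), ∀ b B' : ℝ, |b| ≤ B' →
      |φt x s * b / r₀ x ^ 4| ≤ B * B' * C * (1 / r₀ x) := fun x hx s hs b B' hb =>
    abs_mul_div_pow_four_le (hrpos' x hx) hB0 (hxC x (hIoo hx)) (hφtB s hs x (hIoo hx)) hb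
  have hratio : ∀ x ∈ Ioo 0 M, |x / r₀ x ^ 3| ≤ C := by
    intro x hx
    have := hrpos' x hx
    rw [abs_of_pos (div_pos hx.1 (by positivity)), div_le_iff₀ (by positivity)]
    exact hxC x (hIoo hx)
  have hgrav : ∀ x ∈ Ioo 0 M, ∀ s ∈ Icc (0:ℝ) (t + 1), ∀ b : ℝ, |b| ≤ B * x →
      |φ x s * (x / r₀ x ^ 3 * b) / r₀ x ^ 4| ≤ B * (C * (B * M)) * C * (1 / r₀ x) := by
    intro x hx s hs b hb
    refine abs_mul_div_pow_four_le (hrpos' x hx) hB0 (hxC x (hIoo hx)) (hφB s hs x hx) ?_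
    rw [abs_mul]
    have : B * x ≤ B * M := mul_le_mul_of_nonneg_left hx.2.le hB0
    exact mul_le_mul (hratio x hx) (hb.trans this) (abs_nonneg _) hC.le
  have hφtM' : ∀ x ∈ Ioo 0 M, ∀ s ∈ Icc (0:ℝ) (t + 1), |φt x s| ≤ B * M := fun x hx s hs =>
    (hφtB s hs x (hIoo hx)).trans (mul_le_mul_of_nonneg_left hx.2.le hB0)
  have hr4ne : ∀ x ∈ Ioo 0 M, r₀ x ^ 4 ≠ 0 := fun x hx => (pow_pos (hrpos' x hx) 4).ne'
  have hr3ne : ∀ x ∈ Ioo 0 M, r₀ x ^ 3 ≠ 0 := fun x hx => (pow_pos (hrpos' x hx) 3).ne'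
  have hrc4 : ContinuousOn (fun x => r₀ x ^ 4) (Ioo 0 M) := (hrcont.mono hIoo).pow 4
  have hrc3 : ContinuousOn (fun x => r₀ x ^ 3) (Ioo 0 M) := (hrcont.mono hIoo).pow 3
  have hconst : ∀ c : ℝ, IntegrableOn (fun _ : ℝ => c) (Ioo 0 M) := fun c =>
    integrableOn_const (by simp)
  -- kinetic energy
  have hE₁c : ∀ (c : ℝ) (g : ℝ → ℝ) (B' s : ℝ), s ∈ Icc (0:ℝ) (t + 1) →
      ContinuousOn g (Ioo 0 M) → (∀ x ∈ Ioo 0 M, |g x| ≤ B') →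
      IntegrableOn (fun x => c * (φt x s * g x / r₀ x ^ 4)) (Ioo 0 M) := by
    intro c g B' s hs hg hgB
    refine Integrable.const_mul ?_ c
    exact integrableOn_Ioo_of_continuousOn_of_abs_le
      ((((slice hjc2 s hs.1).mono hIoo).mul hg).div hrc4 hr4ne)
      (hrint.const_mul (B * B' * C)) (fun x hx => hkin x hx s hs _ _ (hgB x hx))
  have hE₁ : HasDerivWithinAt
      (fun s => ∫ x in Ioo (0:ℝ) M, (φt x s)^2/(32*π^2*(r₀ x)^4))
      (∫ x in Ioo (0:ℝ) M, 1/(16*π^2) * (φt x t * φtt x t / r₀ x ^ 4)) (Ici 0) t := by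
    refine hasDerivWithinAt_setIntegral_of_dominated measurableSet_Ioo
      (f := fun x s => (φt x s)^2/(32*π^2*(r₀ x)^4))
      (f' := fun x s => 1/(16*π^2) * (φt x s * φtt x s / r₀ x ^ 4))
      (b := fun x => 1/(16*π^2) * (B * B * C * (1 / r₀ x))) ht0 (lt_add_one t) ?_ ?_ ?_ ?_
    · intro s hs
      refine (hE₁c (1/(32*π^2)) (fun x => φt x s) (B * M) s hs
        ((slice hjc2 s hs.1).mono hIoo) (fun x hx => hφtM' x hx s hs)).congr_fun
        (fun x hx => ?_) measurableSet_Ioo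
      have := hr4ne x hx
      simp only
      field_simp
    · exact (hrint.const_mul (B * B * C)).const_mul _
    · intro x hx s hs
      rw [abs_mul, abs_of_pos (show (0:ℝ) < 1/(16*π^2) by positivity)]
      exact mul_le_mul_of_nonneg_left (hkin x hx s hs _ _ (hB x (hIoo hx) s hs).2.1)
        (by positivity)
    · intro x hx s hs
      have h := (((hdtt x (hIoo hx) s hs.1).mono hIcc).pow 2).div_const (32*π^2*(r₀ x)^4)
      have hr := hr4ne x hx
      refine h.congr_deriv ?_
      field_simp
      norm_num
      ring
  -- potential energy
  have hcoef : ∀ x ∈ Ioo 0 M, ∀ a b : ℝ, deriv P₀ x/(π*(r₀ x)^3) * (a * b)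
      = -(1/(4*π^2)) * (a * (x / r₀ x ^ 3 * b) / r₀ x ^ 4) := by
    intro x hx a b
    have h4 := hr4ne x hx
    have h3 := hr3ne x hx
    rw [hsteady x hx]
    field_simp
  have hE₂c : ∀ (c : ℝ) (g : ℝ → ℝ) (s : ℝ), s ∈ Icc (0:ℝ) (t + 1) →
      ContinuousOn g (Ioo 0 M) → (∀ x ∈ Ioo 0 M, |g x| ≤ B * x) →
      IntegrableOn (fun x => c * (deriv P₀ x/(π*(r₀ x)^3) * (φ x s * g x))) (Ioo 0 M) := by
    intro c g s hs hg hgB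
    refine Integrable.const_mul ?_ c
    have h : IntegrableOn (fun x => φ x s * (x / r₀ x ^ 3 * g x) / r₀ x ^ 4) (Ioo 0 M) :=
      integrableOn_Ioo_of_continuousOn_of_abs_le
        (((hφcont s hs.1).mul ((continuousOn_id.div hrc3 hr3ne).mul hg)).div hrc4 hr4ne)
        (hrint.const_mul _) (fun x hx => hgrav x hx s hs _ (hgB x hx))
    exact IntegrableOn.congr_fun (h.const_mul (-(1/(4*π^2)))) (fun x hx => (hcoef x hx _ _).symm)
      measurableSet_Ioo
  have hcontint : ∀ {g : ℝ → ℝ}, ContinuousOn g (Icc 0 M) → IntegrableOn g (Ioo 0 M) :=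
    fun hg => (hg.integrableOn_compact isCompact_Icc).mono_set hIoo
  have hγPρ : ContinuousOn (fun x => γ * P₀ x * ρ₀ x) (Icc 0 M) :=
    (continuousOn_const.mul hPcont).mul hρcont
  have hE₂i : ∀ s ∈ Icc (0:ℝ) (t + 1), IntegrableOn (fun x => (γ * P₀ x * ρ₀ x/2) * (φx x s)^2
      + (deriv P₀ x/(2*π*(r₀ x)^3)) * (φ x s)^2) (Ioo 0 M) := by
    intro s hs
    refine (hcontint ((hγPρ.div_const 2).mul ((slice hjc1 s hs.1).pow 2))).add ?_
    refine (hE₂c (1/2) (fun x => φ x s) s hs (hφcont s hs.1) (hφB s hs)).congr_fun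
      (fun x hx => ?_) measurableSet_Ioo
    have := hr3ne x hx
    simp only
    field_simp
  have hE₂ : HasDerivWithinAt
      (fun s => ∫ x in Ioo (0:ℝ) M, ((γ * P₀ x * ρ₀ x/2) * (φx x s)^2
            + (deriv P₀ x/(2*π*(r₀ x)^3)) * (φ x s)^2))
      (∫ x in Ioo (0:ℝ) M, (γ * P₀ x * ρ₀ x * (φx x t * φxt x t)
            + deriv P₀ x/(π*(r₀ x)^3) * (φ x t * φt x t))) (Ici 0) t := by
    refine hasDerivWithinAt_setIntegral_of_dominated measurableSet_Ioo
      (f := fun x s => (γ * P₀ x * ρ₀ x/2) * (φx x s)^2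
            + (deriv P₀ x/(2*π*(r₀ x)^3)) * (φ x s)^2)
      (f' := fun x s => γ * P₀ x * ρ₀ x * (φx x s * φxt x s)
            + deriv P₀ x/(π*(r₀ x)^3) * (φ x s * φt x s))
      (b := fun x => A * (B * B) + 1/(4*π^2) * (B * (C * (B * M)) * C * (1 / r₀ x)))
      ht0 (lt_add_one t) ?_ ?_ ?_ ?_
    · exact fun s hs => hE₂i s hs
    · exact (hconst _).add ((hrint.const_mul _).const_mul _)
    · intro x hx s hs
      obtain ⟨b1, -, b3⟩ := hB x (hIoo hx) s hs
      rw [hcoef x hx]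
      refine (abs_add_le _ _).trans (add_le_add ?_ ?_)
      · rw [abs_mul, abs_mul (φx x s)]
        exact mul_le_mul (hA x (hIoo hx)) (mul_le_mul b1 b3 (abs_nonneg _) hB0)
          (by positivity) hA0
      · rw [abs_mul, abs_neg, abs_of_pos (show (0:ℝ) < 1/(4*π^2) by positivity)]
        exact mul_le_mul_of_nonneg_left (hgrav x hx s hs _ (hφtB s hs x (hIoo hx)))
          (by positivity)
    · intro x hx s hs
      have h1 := (hasDerivWithinAt_partial_comm hdx hdt hdxt hjc2 hjc4 hx hs.1).mono hIcc
      have h2 := (hdt x (hIoo hx) s hs.1).mono hIcc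
      refine (((h1.pow 2).const_mul (γ * P₀ x * ρ₀ x/2)).add
        ((h2.pow 2).const_mul (deriv P₀ x/(2*π*(r₀ x)^3)))).congr_deriv ?_
      have hr := hr3ne x hx
      field_simp
      norm_num
      ring
  have hI₁ := hE₁c (1/(16*π^2)) (fun x => φtt x t) B t htI
    ((slice hjc3 t ht).mono hIoo) (fun x hx => (hB x (hIoo hx) t htI).2.1)
  have hI₂ : IntegrableOn (fun x => γ * P₀ x * ρ₀ x * (φx x t * φxt x t)
      + deriv P₀ x/(π*(r₀ x)^3) * (φ x t * φt x t)) (Ioo 0 M) := by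
    refine (hcontint (hγPρ.mul ((slice hjc1 t ht).mul (slice hjc4 t ht)))).add ?_
    simpa using hE₂c 1 (fun x => φt x t) t htI ((slice hjc2 t ht).mono hIoo)
      (fun x hx => hφtB t htI x (hIoo hx))
  -- dissipation
  have hρinv : IntegrableOn (fun x => 1 / ρ₀ x) (Ioo 0 M) := hρint.mono_set Ioo_subset_Ioc_self
  have hstress : IntegrableOn (fun x => 9 / (16*π^2) * (φt x t / r₀ x ^ 3) ^ 2 * (1 / ρ₀ x))
      (Ioo 0 M) := by
    have hq : ContinuousOn (fun x => φt x t / r₀ x ^ 3) (Ioo 0 M) :=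
      ((slice hjc2 t ht).mono hIoo).div hrc3 hr3ne
    refine integrableOn_Ioo_of_continuousOn_of_abs_le
      ((continuousOn_const.mul (hq.pow 2)).mul (continuousOn_const.div (hρcont.mono hIoo)
        fun x hx => (hρpos' x hx).ne')) (hρinv.const_mul (9 / (16*π^2) * (B * C) ^ 2))
      fun x hx => ?_
    have hr := hrpos' x hx
    have hρx := hρpos' x hx
    have hqB : |φt x t / r₀ x ^ 3| ≤ B * C := by
      rw [abs_div, abs_of_pos (pow_pos hr 3), div_le_iff₀ (pow_pos hr 3), mul_assoc]
      exact (hφtB t htI x (hIoo hx)).trans (mul_le_mul_of_nonneg_left (hxC x (hIoo hx)) hB0)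
    rw [abs_of_nonneg (by positivity), ← sq_abs (φt x t / r₀ x ^ 3)]
    gcongr
  have hcross : ContinuousOn (fun x => φxt x t * (φt x t / r₀ x ^ 3)) (Ioo 0 M) :=
    ((slice hjc4 t ht).mono hIoo).mul (((slice hjc2 t ht).mono hIoo).div hrc3 hr3ne)
  have hI₃ : IntegrableOn (fun x => δ * ρ₀ x * (φxt x t)^2
      + (4*ε/3) * ρ₀ x * (φxt x t - 3*φt x t/(4*π*ρ₀ x*(r₀ x)^3))^2) (Ioo 0 M) := by
    have hci : IntegrableOn (fun x => φxt x t * (φt x t / r₀ x ^ 3)) (Ioo 0 M) := by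
      refine integrableOn_Ioo_of_continuousOn_of_abs_le hcross (hconst (B * (B * C)))
        fun x hx => ?_
      have hr := hrpos' x hx
      rw [abs_mul, abs_div, abs_of_pos (pow_pos hr 3)]
      refine mul_le_mul (hB x (hIoo hx) t htI).2.2 ?_ (by positivity) hB0
      rw [div_le_iff₀ (pow_pos hr 3), mul_assoc]
      exact (hφtB t htI x (hIoo hx)).trans (mul_le_mul_of_nonneg_left (hxC x (hIoo hx)) hB0)
    have h1 : IntegrableOn (fun x => (δ + 4*ε/3) * ρ₀ x * (φxt x t)^2) (Ioo 0 M) :=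
      hcontint ((continuousOn_const.mul hρcont).mul ((slice hjc4 t ht).pow 2))
    refine ((h1.add (hci.const_mul (-(2*ε/π)))).add (hstress.const_mul (4*ε/3))).congr_fun
      (fun x hx => ?_) measurableSet_Ioo
    have hr := hr3ne x hx
    have hρx := (hρpos' x hx).ne'
    simp only [Pi.add_apply]
    field_simp
    ring
  refine ⟨_, _, hE₁, hE₂, ?_⟩
  have hsum := integral_add (hI₁.add hI₃) hI₂
  simp only [Pi.add_apply] at hsum
  rw [eq_neg_iff_add_eq_zero, ← integral_add hI₁ hI₃, ← hsum,
    ← integral_Ioc_eq_integral_Ioo, ← intervalIntegral.integral_of_le hM.le]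
  have hWcont : ContinuousOn (fun y => ((4*ε/3 + δ) * ρ₀ y * φxt y t
      + γ * P₀ y * ρ₀ y * φx y t) * φt y t - ε/π * (φt y t ^ 2 / r₀ y ^ 3)) (Icc 0 M) :=
    ((hFcont t ht).mul (slice hjc2 t ht)).sub (continuousOn_const.mul
      (continuousOn_sq_div_of_abs_le (slice hjc2 t ht) (hrcont.pow 3)
        (fun x hx => pow_pos (hrpos x hx) 3) (hφtB t htI) hxC))
  refine (intervalIntegral.integral_eq_sub_of_hasDerivAt_of_le hM.le hWcont (fun x hx => ?_)
    ((intervalIntegrable_iff_integrableOn_Ioo_of_le hM.le).2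
      ((hI₁.add hI₃).add hI₂))).trans ?_
  rotate_left
  · simp [hφtM, hφt0 t ht]
  · have hr := hr3ne x hx
    have hr' := (hrpos' x hx).ne'
    have hρx := (hρpos' x hx).ne'
    have hS := hasDerivAt_radius_cube hρcont hρpos hρint hr₀ hx
    have hφ' := hdxt t ht x hx
    refine (((hG t ht x hx).mul hφ').sub
      (((hφ'.pow 2).div hS hr).const_mul (ε/π))).congr_deriv ?_
    have hpde : G x t = deriv P₀ x/(π*(r₀ x)^3) * φ x t + φtt x t/(16*π^2*(r₀ x)^4) := by
      have h := heq t ht x hx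
      rw [neg_div] at h
      linarith
    simp only [Pi.add_apply, Pi.pow_apply]
    rw [hpde]
    field_simp
    ring
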